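/- arXiv:2410.18640 — 3 statements merged into one kernel-verified Lean document; each statement's English description precedes it below -/
import Mathlib

section
/- Let X be a type, let k be a positive natural number, let r, r' : X → Fin k → ℝ be two reward functions over k responses indexed by Fin k that lie in the same equivalence class, i.e. there exists f : X → ℝ with r'(x, i) = r(x, i) + f(x) for all x and i. Then r and r' induce the same Plackett-Luce ranking distribution: for every x and every permutation τ of Fin k, ∏_{j : Fin k} exp(r'(x, τ(j))) / (∑_{l : Fin k, l ≥ j} exp(r'(x, τ(l)))) = ∏_{j : Fin k} exp(r(x, τ(j))) / (∑_{l : Fin k, l ≥ j} exp(r(x, τ(l)))), where l ≥ j refers to the order on Fin k. -/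
theorem plackett_luce_invariant_under_equivalence
    {X : Type*} (k : ℕ) (hk : 0 < k)
    (r r' : X → Fin k → ℝ) (f : X → ℝ)
    (hclass : ∀ x i, r' x i = r x i + f x) :
    ∀ (x : X) (τ : Equiv.Perm (Fin k)),
      ∏ j : Fin k,
          Real.exp (r' x (τ j)) /
            (∑ l ∈ Finset.univ.filter (fun l : Fin k => j ≤ l), Real.exp (r' x (τ l))) =
        ∏ j : Fin k,
          Real.exp (r x (τ j)) /
            (∑ l ∈ Finset.univ.filter (fun l : Fin k => j ≤ l), Real.exp (r x (τ l))) := by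
  intro x τ
  refine Finset.prod_congr rfl fun j _ => ?_
  simp only [hclass, Real.exp_add]
  rw [← Finset.sum_mul]
  exact mul_div_mul_right _ _ (Real.exp_ne_zero _)
end

section
/- Let Y be a nonempty finite type, let π_ref : Y → ℝ be a probability mass function with π_ref(y) > 0 for all y, let β > 0, and let r : Y → ℝ be any reward function. Then there exists a probability mass function π : Y → ℝ with π(y) > 0 for all y and a constant c : ℝ such that r(y) = β·log(π(y)/π_ref(y)) + c for all y; concretely, π(y) = π_ref(y)·exp(r(y)/β)/Z with Z = ∑_z π_ref(z)·exp(r(z)/β) and c = β·log Z. In particular, the reparameterized reward r'(y) = β·log(π(y)/π_ref(y)) lies in the same equivalence class as r (they differ by the constant c), so every reward class consistent with the Bradley-Terry model can be represented in the form β·log(π(y)/π_ref(y)) for some policy π (Theorem 1 of the paper, fixed-prompt form). -/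
theorem reward_reparameterization_exists
    {Y : Type*} [Fintype Y] [Nonempty Y]
    (π_ref : Y → ℝ) (href_pos : ∀ y, 0 < π_ref y) (href_sum : ∑ y, π_ref y = 1)
    (β : ℝ) (hβ : 0 < β) (r : Y → ℝ) :
    ∃ (π : Y → ℝ) (c : ℝ),
      (∀ y, 0 < π y) ∧ (∑ y, π y = 1) ∧
      (∀ y, π y = π_ref y * Real.exp (r y / β) / (∑ z, π_ref z * Real.exp (r z / β))) ∧
      c = β * Real.log (∑ z, π_ref z * Real.exp (r z / β)) ∧
      (∀ y, r y = β * Real.log (π y / π_ref y) + c) := by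
  have hZ : 0 < ∑ z, π_ref z * Real.exp (r z / β) :=
    Finset.sum_pos (fun z _ => mul_pos (href_pos z) (Real.exp_pos _)) Finset.univ_nonempty
  refine ⟨fun y => π_ref y * Real.exp (r y / β) / (∑ z, π_ref z * Real.exp (r z / β)), _,
    fun y => div_pos (mul_pos (href_pos y) (Real.exp_pos _)) hZ, ?_, fun _ => rfl, rfl, ?_⟩
  · rw [← Finset.sum_div]
    exact div_self hZ.ne'
  · intro y
    have hy := (href_pos y).ne'
    have h : π_ref y * Real.exp (r y / β) / (∑ z, π_ref z * Real.exp (r z / β)) / π_ref y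
        = Real.exp (r y / β) / (∑ z, π_ref z * Real.exp (r z / β)) := by
      rw [div_right_comm, mul_div_cancel_left₀ _ hy]
    simp only [h]
    rw [Real.log_div (Real.exp_pos _).ne' hZ.ne', Real.log_exp, mul_sub,
      mul_div_cancel₀ _ hβ.ne']
    ring
end

section
/- Let Y be a nonempty finite type, let π_ref_w, π_r_w, π_ref_s, π_θ : Y → ℝ be everywhere-positive probability mass functions, and let γ > 0. Suppose the WSPO matching condition holds: γ·log(π_θ(y)/π_ref_s(y)) = log(π_r_w(y)/π_ref_w(y)) for all y. Then the partition function Z' = ∑_y π_ref_s(y)·(π_r_w(y)/π_ref_w(y))^(1/γ) equals 1, and consequently π_θ equals the Gibbs policy of the transferred reward: π_θ(y) = π_ref_s(y)·(π_r_w(y)/π_ref_w(y))^(1/γ) for all y. -/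
theorem wspo_matching_implies_gibbs
    {Y : Type*} [Fintype Y] [Nonempty Y]
    (π_ref_w π_r_w π_ref_s π_θ : Y → ℝ)
    (hw_pos : ∀ y, 0 < π_ref_w y) (hw_sum : ∑ y, π_ref_w y = 1)
    (hrw_pos : ∀ y, 0 < π_r_w y) (hrw_sum : ∑ y, π_r_w y = 1)
    (hs_pos : ∀ y, 0 < π_ref_s y) (hs_sum : ∑ y, π_ref_s y = 1)
    (hθ_pos : ∀ y, 0 < π_θ y) (hθ_sum : ∑ y, π_θ y = 1)
    (γ : ℝ) (hγ : 0 < γ)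
    (hmatch : ∀ y, γ * Real.log (π_θ y / π_ref_s y) = Real.log (π_r_w y / π_ref_w y)) :
    (∑ y, π_ref_s y * (π_r_w y / π_ref_w y) ^ (1 / γ)) = 1 ∧
    (∀ y, π_θ y = π_ref_s y * (π_r_w y / π_ref_w y) ^ (1 / γ)) := by
  have key : ∀ y, π_θ y = π_ref_s y * (π_r_w y / π_ref_w y) ^ (1 / γ) := by
    intro y
    have h1 : Real.log (π_r_w y / π_ref_w y) * (1 / γ) = Real.log (π_θ y / π_ref_s y) := by
      rw [← hmatch y]
      field_simp
    rw [Real.rpow_def_of_pos (div_pos (hrw_pos y) (hw_pos y)), h1,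
      Real.exp_log (div_pos (hθ_pos y) (hs_pos y)), mul_div_cancel₀ _ (hs_pos y).ne']
  refine ⟨?_, key⟩
  exact (Finset.sum_congr rfl fun y _ => (key y).symm).trans hθ_sum
end
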